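/- A continuous linear operator T : E → F between Banach spaces is completely continuous if and only if for every Banach space G and every weakly compact operator S : G → E, the composition T∘S : G → F is compact. (In ideal notation: 𝔙 = 𝔎∘𝔚^{-1}.) -/

import Mathlib

open Filter Topology Bornology Metric Set

/-- A real Banach space: a complete normed real vector space. -/
class BanachR (E : Type) extends NormedAddCommGroup E, NormedSpace ℝ E, CompleteSpace E

section Defs

variable {E F : Type} [BanachR E] [BanachR F]

/-- `T` is compact: the image of the closed unit ball is totally bounded. -/
def CompactOp (T : E →L[ℝ] F) : Prop :=
  TotallyBounded (T '' closedBall 0 1)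

/-- `T` is weakly compact: the image of the closed unit ball is relatively compact in the
weak topology `σ(F,F')`. -/
def WeaklyCompactOp (T : E →L[ℝ] F) : Prop :=
  IsCompact (closure (toWeakSpace ℝ F '' (T '' closedBall 0 1)))

/-- A sequence converges weakly to `x₀` if `f xₙ → f x₀` for every `f ∈ E'`. -/
def WeaklyConvergent (x : ℕ → E) (x₀ : E) : Prop :=
  ∀ f : E →L[ℝ] ℝ, Tendsto (fun n => f (x n)) atTop (𝓝 (f x₀))

/-- `T` is completely continuous: it maps weakly convergent sequences to norm-convergent
sequences. -/
def CompletelyContinuousOp (T : E →L[ℝ] F) : Prop :=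
  ∀ (x : ℕ → E) (x₀ : E), WeaklyConvergent x x₀ →
    ∃ y : F, Tendsto (fun n => T (x n)) atTop (𝓝 y)

/-- A Banach–Saks sequence: its Cesàro means converge in norm. -/
def BanachSaksSeq (x : ℕ → F) : Prop :=
  ∃ x₀ : F, Tendsto (fun n : ℕ => (n : ℝ)⁻¹ • ∑ i ∈ Finset.range n, x i) atTop (𝓝 x₀)

/-- `T` is a Banach–Saks operator: every bounded sequence has a subsequence whose image
under `T` is a Banach–Saks sequence. -/
def BanachSaksOp (T : E →L[ℝ] F) : Prop :=
  ∀ x : ℕ → E, IsBounded (range x) →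
    ∃ φ : ℕ → ℕ, StrictMono φ ∧ BanachSaksSeq (fun k => T (x (φ k)))

/-- `T` is weakly Banach–Saks: it sends each weakly convergent sequence to a sequence
possessing a Banach–Saks subsequence. -/
def WeaklyBanachSaksOp (T : E →L[ℝ] F) : Prop :=
  ∀ (x : ℕ → E) (x₀ : E), WeaklyConvergent x x₀ →
    ∃ φ : ℕ → ℕ, StrictMono φ ∧ BanachSaksSeq (fun k => T (x (φ k)))

/-- A weakly Cauchy sequence: `⟨xₙ, f⟩` converges for every `f ∈ E'`. -/
def WeaklyCauchy (x : ℕ → E) : Prop :=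
  ∀ f : E →L[ℝ] ℝ, ∃ c : ℝ, Tendsto (fun n => f (x n)) atTop (𝓝 c)

/-- `T` is Rosenthal compact: every bounded sequence has a subsequence whose image under
`T` is weakly Cauchy. -/
def RosenthalCompactOp (T : E →L[ℝ] F) : Prop :=
  ∀ x : ℕ → E, IsBounded (range x) →
    ∃ φ : ℕ → ℕ, StrictMono φ ∧ WeaklyCauchy (fun k => T (x (φ k)))

/-- `T` is a weakly sequentially complete operator: it sends each weakly Cauchy sequence
to a sequence having a weakly convergent subsequence. -/
def WeaklySeqCompleteOp (T : E →L[ℝ] F) : Prop :=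
  ∀ x : ℕ → E, WeaklyCauchy x →
    ∃ φ : ℕ → ℕ, StrictMono φ ∧ ∃ y₀ : F, WeaklyConvergent (fun k => T (x (φ k))) y₀

end Defs

section WeakCompactness

variable {E : Type*} [NormedAddCommGroup E] [NormedSpace ℝ E]

lemma WeakSpace.continuous_eval (f : E →L[ℝ] ℝ) :
    Continuous fun x : WeakSpace ℝ E => f ((toWeakSpace ℝ E).symm x) :=
  WeakBilin.eval_continuous (topDualPairing ℝ E).flip f

/-- Countably many functionals separate the points of a separable subspace. -/
lemma exists_countable_separating_dual {M : Submodule ℝ E}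
    (hM : TopologicalSpace.IsSeparable (M : Set E)) :
    ∃ (t : Set E) (g : E → E →L[ℝ] ℝ), t.Countable ∧
      ∀ x ∈ M, ∀ y ∈ M, (∀ d ∈ t, g d x = g d y) → x = y := by
  obtain ⟨t, htM, htc, hMt⟩ := hM.exists_countable_dense_subset
  choose g hg1 hg2 using fun x : E => exists_dual_vector'' ℝ x
  refine ⟨t, g, htc, fun x hx y hy h => ?_⟩
  have hz : x - y ∈ closure t := hMt (M.sub_mem hx hy)
  rw [← sub_eq_zero, ← norm_le_zero_iff]
  refine le_of_forall_pos_le_add fun ε hε => ?_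
  obtain ⟨d, hd, hdist⟩ := Metric.mem_closure_iff.1 hz (ε / 2) (half_pos hε)
  have hgz : g d (x - y) = 0 := by rw [map_sub, h d hd, sub_self]
  have h1 : ‖d‖ ≤ ‖x - y - d‖ := by
    have h2 : g d (d - (x - y)) = ‖d‖ := by
      rw [map_sub, hgz, sub_zero]; exact hg2 d
    calc ‖d‖ = g d (d - (x - y)) := h2.symm
      _ ≤ ‖g d (d - (x - y))‖ := Real.le_norm_self _
      _ ≤ ‖g d‖ * ‖d - (x - y)‖ := (g d).le_opNorm _
      _ ≤ 1 * ‖d - (x - y)‖ := by gcongr; exact hg1 d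
      _ = ‖x - y - d‖ := by rw [one_mul, norm_sub_rev]
  rw [dist_eq_norm] at hdist
  have h3 : ‖x - y‖ ≤ ‖x - y - d‖ + ‖d‖ := by
    simpa using norm_add_le (x - y - d) d
  linarith

/-- The Šmulian half of the Eberlein–Šmulian theorem: weakly compact sets are weakly
sequentially compact. -/
theorem IsCompact.isSeqCompact_weakSpace {K : Set (WeakSpace ℝ E)} (hK : IsCompact K) :
    IsSeqCompact K := by
  intro y hy
  set e := toWeakSpace ℝ E
  set M : Submodule ℝ E := (Submodule.span ℝ (range fun n => e.symm (y n))).topologicalClosure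
  have hMsep : TopologicalSpace.IsSeparable (M : Set E) :=
    ((countable_range _).isSeparable.span (R := ℝ)).closure
  have hMclosed : IsClosed (e '' (M : Set E)) := by
    have h := M.convex.toWeakSpace_closure (𝕜 := ℝ)
    rw [(Submodule.isClosed_topologicalClosure _).closure_eq] at h
    rw [h]
    exact isClosed_closure
  obtain ⟨t, g, htc, hsep⟩ := exists_countable_separating_dual hMsep
  set K' : Set (WeakSpace ℝ E) := K ∩ e '' (M : Set E)
  have hK' : IsCompact K' := hK.inter_right hMclosed
  have : CompactSpace K' := isCompact_iff_compactSpace.1 hK'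
  have : Countable t := htc
  let Φ : K' → t → ℝ := fun x d => g d (e.symm x)
  have hΦc : Continuous Φ :=
    continuous_pi fun d => (WeakSpace.continuous_eval (g d)).comp continuous_subtype_val
  have hΦi : Function.Injective Φ := by
    rintro ⟨_, _, x, hx, rfl⟩ ⟨_, _, x', hx', rfl⟩ h
    have : x = x' := hsep x hx x' hx' fun d hd => by
      simpa [Φ] using congrFun h ⟨d, hd⟩
    subst this
    rfl
  have : FirstCountableTopology K' :=
    (hΦc.isClosedEmbedding hΦi).isInducing.firstCountableTopology
  have hyM : ∀ n, y n ∈ K' := fun n =>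
    ⟨hy n, e.symm (y n), Submodule.le_topologicalClosure _
      (Submodule.subset_span (mem_range_self n)), e.apply_symm_apply _⟩
  obtain ⟨a, -, φ, hφ, ha⟩ :=
    (isCompact_univ (X := K')).isSeqCompact (x := fun n => ⟨y n, hyM n⟩) fun _ => mem_univ _
  exact ⟨a, a.2.1, φ, hφ, (continuous_subtype_val.tendsto a).comp ha⟩

lemma exists_norm_le_of_weakly_tendsto {x : ℕ → E} {x₀ : E}
    (hx : ∀ f : E →L[ℝ] ℝ, Tendsto (fun n => f (x n)) atTop (𝓝 (f x₀))) :
    ∃ C, ∀ n, ‖x n‖ ≤ C := by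
  obtain ⟨C, hC⟩ := banach_steinhaus (g := fun n => NormedSpace.inclusionInDoubleDual ℝ E (x n))
    fun f => by
      obtain ⟨C, hC⟩ := (hx f).norm.bddAbove_range
      exact ⟨C, fun n => hC (mem_range_self n)⟩
  refine ⟨C, fun n => NormedSpace.norm_le_dual_bound ℝ (x n) ((norm_nonneg _).trans (hC 0))
    fun f => ?_⟩
  calc ‖f (x n)‖ = ‖NormedSpace.inclusionInDoubleDual ℝ E (x n) f‖ := rfl
    _ ≤ ‖NormedSpace.inclusionInDoubleDual ℝ E (x n)‖ * ‖f‖ := ContinuousLinearMap.le_opNorm _ _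
    _ ≤ C * ‖f‖ := by gcongr; exact hC n

lemma eq_of_forall_dual_tendsto {x : ℕ → E} {a b : E}
    (ha : ∀ f : E →L[ℝ] ℝ, Tendsto (fun n => f (x n)) atTop (𝓝 (f a)))
    (hb : Tendsto x atTop (𝓝 b)) : b = a :=
  (SeparatingDual.eq_iff_forall_dual_eq (R := ℝ)).2 fun f =>
    tendsto_nhds_unique ((f.continuous.tendsto b).comp hb) (ha f)

/-- In a totally bounded set of a complete space, weak convergence of sequences implies norm
convergence. -/
lemma tendsto_of_weakly_tendsto_of_totallyBounded [CompleteSpace E] {s : Set E}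
    (hs : TotallyBounded s) {x : ℕ → E} {x₀ : E} (hxs : ∀ n, x n ∈ s)
    (hx : ∀ f : E →L[ℝ] ℝ, Tendsto (fun n => f (x n)) atTop (𝓝 (f x₀))) :
    Tendsto x atTop (𝓝 x₀) := by
  refine tendsto_of_subseq_tendsto fun ns hns => ?_
  have hc : IsCompact (closure s) := hs.closure.isCompact_of_isClosed isClosed_closure
  obtain ⟨b, -, φ, hφ, hb⟩ := hc.isSeqCompact fun n => subset_closure (hxs (ns n))
  have : b = x₀ := eq_of_forall_dual_tendsto
    (fun f => (hx f).comp (hns.comp hφ.tendsto_atTop)) hb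
  exact ⟨φ, this ▸ hb⟩

end WeakCompactness

section SequenceOperator

variable {E : Type*} [NormedAddCommGroup E] [NormedSpace ℝ E] [CompleteSpace E]

/-- The set of real sequences with `∑ |aₙ| ≤ 1`. -/
def absSumLeOne : Set (ℕ → ℝ) := {a | ∀ s : Finset ℕ, ∑ n ∈ s, |a n| ≤ 1}

lemma isCompact_absSumLeOne : IsCompact absSumLeOne := by
  refine (isCompact_univ_pi fun _ : ℕ => isCompact_Icc (a := (-1 : ℝ)) (b := 1)).of_isClosed_subset
    ?_ fun a ha n _ => abs_le.1 (by simpa using ha {n})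
  simp only [absSumLeOne, ofPred_forall]
  exact isClosed_iInter fun s => isClosed_le (by fun_prop) continuous_const

lemma summable_abs_of_mem_absSumLeOne {a : ℕ → ℝ} (ha : a ∈ absSumLeOne) :
    Summable fun n => |a n| :=
  summable_of_sum_le (fun _ => abs_nonneg _) ha

lemma summable_smul_of_norm_le {z : ℕ → E} {C : ℝ} (hC : ∀ n, ‖z n‖ ≤ C) {a : ℕ → ℝ}
    (ha : Summable fun n => |a n|) : Summable fun n => a n • z n := by
  refine .of_norm_bounded (ha.mul_right C) fun n => ?_
  rw [norm_smul, Real.norm_eq_abs]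
  gcongr
  exact hC n

lemma continuousOn_tsum_mul_absSumLeOne {c : ℕ → ℝ} (hc : Tendsto c atTop (𝓝 0)) :
    ContinuousOn (fun a : ℕ → ℝ => ∑' n, a n * c n) absSumLeOne := by
  obtain ⟨C, hC⟩ := hc.norm.bddAbove_range
  have hC' : ∀ n, ‖c n‖ ≤ C := fun n => hC (mem_range_self n)
  have hunif : TendstoUniformlyOn (fun (N : ℕ) (a : ℕ → ℝ) => ∑ n ∈ Finset.range N, a n * c n)
      (fun a => ∑' n, a n * c n) atTop absSumLeOne := by
    rw [Metric.tendstoUniformlyOn_iff]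
    intro ε hε
    obtain ⟨N, hN⟩ := Metric.tendsto_atTop.1 hc (ε / 2) (half_pos hε)
    filter_upwards [eventually_ge_atTop N] with m hm a ha
    have hs : Summable fun n => a n * c n :=
      summable_smul_of_norm_le hC' (summable_abs_of_mem_absSumLeOne ha)
    have ha' := summable_abs_of_mem_absSumLeOne ha
    rw [← hs.sum_add_tsum_nat_add m, dist_eq_norm, add_sub_cancel_left]
    have hle : ‖∑' n, a (n + m) * c (n + m)‖ ≤ ∑' n, |a (n + m)| * (ε / 2) := by
      refine tsum_of_norm_bounded (((summable_nat_add_iff m).2 ha').mul_right _).hasSum fun n => ?_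
      rw [norm_mul, Real.norm_eq_abs]
      gcongr
      simpa using (hN (n + m) (by omega)).le
    have h1 : ∑' n, |a (n + m)| ≤ 1 := by
      have h2 := ha'.sum_add_tsum_nat_add m
      have h3 : ∑' n, |a n| ≤ 1 := ha'.tsum_le_of_sum_le ha
      have h4 : 0 ≤ ∑ n ∈ Finset.range m, |a n| := Finset.sum_nonneg fun _ _ => abs_nonneg _
      linarith
    rw [tsum_mul_right] at hle
    nlinarith
  exact hunif.continuousOn (Frequently.of_forall fun N => by fun_prop)

lemma isCompact_toWeakSpace_image_tsum {z : ℕ → E}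
    (hz : ∀ f : E →L[ℝ] ℝ, Tendsto (fun n => f (z n)) atTop (𝓝 0)) :
    IsCompact ((fun a : ℕ → ℝ => toWeakSpace ℝ E (∑' n, a n • z n)) '' absSumLeOne) := by
  obtain ⟨C, hC⟩ := exists_norm_le_of_weakly_tendsto (x := z) (x₀ := 0) (by simpa using hz)
  refine isCompact_absSumLeOne.image_of_continuousOn ?_
  rw [continuousOn_iff_continuous_domRestrict]
  refine WeakBilin.continuous_of_continuous_eval _ fun f => ?_
  have h := continuousOn_iff_continuous_domRestrict.1 (continuousOn_tsum_mul_absSumLeOne (hz f))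
  refine h.congr fun a => ?_
  have hs := summable_smul_of_norm_le hC (summable_abs_of_mem_absSumLeOne a.2)
  have := f.map_tsum hs
  simp only [map_smul, smul_eq_mul] at this
  exact this.symm

lemma lp_one_hasSum_abs (a : lp (fun _ : ℕ => ℝ) 1) : HasSum (fun n => |a n|) ‖a‖ := by
  simpa using lp.hasSum_norm (p := 1) (by simp) a

/-- The operator `ℓ¹ → E` sending the unit vectors to the terms of a bounded sequence. -/
noncomputable def lpOneLift (z : ℕ → E) (C : ℝ) (hC : ∀ n, ‖z n‖ ≤ C) :
    lp (fun _ : ℕ => ℝ) 1 →L[ℝ] E :=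
  LinearMap.mkContinuous
    { toFun := fun a => ∑' n, a n • z n
      map_add' := fun a b => by
        simp only [lp.coeFn_add, Pi.add_apply, add_smul]
        exact (summable_smul_of_norm_le hC (lp_one_hasSum_abs a).summable).tsum_add
          (summable_smul_of_norm_le hC (lp_one_hasSum_abs b).summable)
      map_smul' := fun r a => by
        simp only [lp.coeFn_smul, Pi.smul_apply, smul_eq_mul, mul_smul, RingHom.id_apply]
        exact (summable_smul_of_norm_le hC (lp_one_hasSum_abs a).summable).tsum_const_smul r }
    C fun a => by
      rw [mul_comm]
      refine tsum_of_norm_bounded ((lp_one_hasSum_abs a).mul_right C) fun n => ?_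
      rw [norm_smul, Real.norm_eq_abs]
      gcongr
      exact hC n

lemma lpOneLift_apply (z : ℕ → E) (C : ℝ) (hC : ∀ n, ‖z n‖ ≤ C)
    (a : lp (fun _ : ℕ => ℝ) 1) : lpOneLift z C hC a = ∑' n, a n • z n :=
  rfl

lemma lpOneLift_single (z : ℕ → E) (C : ℝ) (hC : ∀ n, ‖z n‖ ≤ C) (n : ℕ) :
    lpOneLift z C hC (lp.single 1 n (1 : ℝ)) = z n := by
  rw [lpOneLift_apply, tsum_eq_single n fun m hm => by simp [hm]]
  simp

lemma image_closedBall_lpOneLift_subset (z : ℕ → E) (C : ℝ) (hC : ∀ n, ‖z n‖ ≤ C) :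
    toWeakSpace ℝ E '' (lpOneLift z C hC '' closedBall 0 1) ⊆
      (fun a : ℕ → ℝ => toWeakSpace ℝ E (∑' n, a n • z n)) '' absSumLeOne := by
  rintro _ ⟨_, ⟨a, ha, rfl⟩, rfl⟩
  refine ⟨a, fun s => ?_, rfl⟩
  exact (sum_le_hasSum s (fun _ _ => abs_nonneg _) (lp_one_hasSum_abs a)).trans
    (by simpa using ha)

end SequenceOperator

noncomputable instance lp.banachR : BanachR (lp (fun _ : ℕ => ℝ) 1) where
  __ := (inferInstance : NormedAddCommGroup (lp (fun _ : ℕ => ℝ) 1))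
  __ := (inferInstance : NormedSpace ℝ (lp (fun _ : ℕ => ℝ) 1))
  __ := (inferInstance : CompleteSpace (lp (fun _ : ℕ => ℝ) 1))

section Operators

variable {E F : Type} [BanachR E] [BanachR F]

lemma CompletelyContinuousOp.compactOp_comp {T : E →L[ℝ] F} (hT : CompletelyContinuousOp T)
    {G : Type} [BanachR G] {S : G →L[ℝ] E} (hS : WeaklyCompactOp S) :
    CompactOp (T.comp S) := by
  have hseq : IsSeqCompact (T '' (toWeakSpace ℝ E ⁻¹'
      closure (toWeakSpace ℝ E '' (S '' closedBall 0 1)))) := by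
    intro y hy
    choose x hxK hxy using hy
    obtain ⟨a, haK, φ, hφ, ha⟩ := hS.isSeqCompact_weakSpace hxK
    have hweak : WeaklyConvergent (x ∘ φ) ((toWeakSpace ℝ E).symm a) := fun f =>
      ((WeakSpace.continuous_eval f).tendsto a).comp ha
    obtain ⟨b, hb⟩ := hT _ _ hweak
    have hbT : b = T ((toWeakSpace ℝ E).symm a) :=
      eq_of_forall_dual_tendsto (fun f => hweak (f.comp T)) hb
    refine ⟨b, ⟨(toWeakSpace ℝ E).symm a, by simpa using haK, hbT.symm⟩, φ, hφ, ?_⟩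
    exact hb.congr fun n => hxy (φ n)
  refine hseq.totallyBounded.subset ?_
  rintro _ ⟨g, hg, rfl⟩
  exact ⟨S g, mem_preimage.2 (subset_closure ⟨S g, ⟨g, hg, rfl⟩, rfl⟩), rfl⟩

lemma completelyContinuousOp_of_comp_compactOp {T : E →L[ℝ] F}
    (hT : ∀ S : lp (fun _ : ℕ => ℝ) 1 →L[ℝ] E, WeaklyCompactOp S → CompactOp (T.comp S)) :
    CompletelyContinuousOp T := by
  intro x x₀ hx
  have hz : ∀ f : E →L[ℝ] ℝ, Tendsto (fun n => f (x n - x₀)) atTop (𝓝 0) := fun f => by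
    simpa using (hx f).sub_const (f x₀)
  obtain ⟨C, hC⟩ := exists_norm_le_of_weakly_tendsto (x := fun n => x n - x₀) (x₀ := 0)
    (by simpa using hz)
  have hS : WeaklyCompactOp (lpOneLift _ C hC) :=
    (isCompact_toWeakSpace_image_tsum hz).closure_of_subset
      (image_closedBall_lpOneLift_subset _ C hC)
  have hlim : Tendsto (fun n => T (x n - x₀)) atTop (𝓝 0) := by
    refine tendsto_of_weakly_tendsto_of_totallyBounded (hT _ hS) (fun n => ?_)
      fun f => by simpa using hz (f.comp T)
    refine ⟨lp.single 1 n (1 : ℝ), ?_, congrArg T (lpOneLift_single _ C hC n)⟩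
    rw [mem_closedBall_zero_iff]
    exact (lp.norm_single (by simp) _ _).le.trans (by simp)
  refine ⟨T x₀, ?_⟩
  simpa using hlim.add_const (T x₀)

end Operators

/-- A continuous linear operator `T : E → F` between Banach spaces is
completely continuous iff `T ∘ S` is compact for every weakly compact operator `S` from
any Banach space `G` into `E`.  (`𝔙 = 𝔎 ∘ 𝔚⁻¹`.) -/
theorem completelyContinuous_iff_comp_weaklyCompact_compact
    (E F : Type) [BanachR E] [BanachR F] (T : E →L[ℝ] F) :
    CompletelyContinuousOp T ↔
      ∀ (G : Type) [BanachR G] (S : G →L[ℝ] E),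
        WeaklyCompactOp S → CompactOp (T.comp S) := by
  exact ⟨fun hT _ _ _ hS => hT.compactOp_comp hS,
    fun hT => completelyContinuousOp_of_comp_compactOp (hT _)⟩
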